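/- arXiv:1006.1587 — 3 statements merged into one kernel-verified Lean document; each statement's English description precedes it below -/
import Mathlib

section
/- For every tournament T on at least one vertex (a digraph in which for every pair of distinct vertices exactly one of the two possible arcs is present), the hat number satisfies h(T) = 1/2. -/
namespace HatProblem

variable {V : Type*} [Fintype V] [DecidableEq V]

/-- A team strategy: each vertex maps a full configuration to a guess (`none` = pass),
depending only on the colors of its out-neighbors. -/
def IsStrategy (A : V → V → Prop) (S : V → (V → Bool) → Option Bool) : Prop :=
  ∀ (v : V) (c c' : V → Bool), (∀ u, A v u → c u = c' u) → S v c = S v c'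

/-- The team wins at configuration `c`: someone guesses correctly, nobody guesses wrong. -/
def Wins (S : V → (V → Bool) → Option Bool) (c : V → Bool) : Prop :=
  (∃ v, S v c = some (c v)) ∧ ∀ v b, S v c = some b → b = c v

/-- The chance of success of a strategy. -/
noncomputable def chance (S : V → (V → Bool) → Option Bool) : ℚ :=
  ({c : V → Bool | Wins S c}.ncard : ℚ) / 2 ^ Fintype.card V

/-- The hat number of a digraph: the maximal chance of success over all strategies. -/
noncomputable def hatNumber (A : V → V → Prop) : ℚ :=
  haveI : Fintype {S : V → (V → Bool) → Option Bool // IsStrategy A S} :=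
    Fintype.ofFinite _
  Finset.sup' (Finset.univ : Finset {S : V → (V → Bool) → Option Bool // IsStrategy A S})
    ⟨⟨fun _ _ => none, fun _ _ _ _ => rfl⟩, Finset.mem_univ _⟩
    fun S => chance S.1

/-- A clique in the skeleton of a digraph: vertices pairwise joined by arcs both ways. -/
def IsDiClique (A : V → V → Prop) (s : Finset V) : Prop :=
  ∀ x ∈ s, ∀ y ∈ s, x ≠ y → A x y ∧ A y x

/-- The clique number of a digraph: the clique number of its skeleton. -/
noncomputable def cliqueNum (A : V → V → Prop) : ℕ :=
  sSup {n | ∃ s : Finset V, IsDiClique A s ∧ s.card = n}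

/-- The directed union `C → D` of two digraphs. -/
def dUnion {W : Type*} (A : V → V → Prop) (B : W → W → Prop) :
    V ⊕ W → V ⊕ W → Prop
  | Sum.inl x, Sum.inl y => A x y
  | Sum.inl _, Sum.inr _ => True
  | Sum.inr _, Sum.inl _ => False
  | Sum.inr x, Sum.inr y => B x y

/-- The complete digraph on `m` vertices. -/
def completeArc (m : ℕ) : Fin m → Fin m → Prop := fun a b => a ≠ b

end HatProblem

namespace HatProblem

section

variable {V : Type*} [DecidableEq V]

/-- The configuration obtained from `c` by changing the color of `v`. -/
def flip (c : V → Bool) (v : V) : V → Bool := Function.update c v (!c v)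

lemma flip_flip (c : V → Bool) (v : V) : flip (flip c v) v = c := by
  simp [flip]

lemma flip_of_ne (c : V → Bool) {u v : V} (h : u ≠ v) : flip c v u = c u :=
  Function.update_of_ne h _ _

lemma flip_self (c : V → Bool) (v : V) : flip c v v = !c v :=
  Function.update_self _ _ _

lemma flip_injective (v : V) : Function.Injective fun c : V → Bool => flip c v :=
  Function.LeftInverse.injective (g := fun c => flip c v) fun c => flip_flip c v

/-- A vertex that does not see `u` keeps its guess when `u` changes color. -/
lemma IsStrategy.apply_flip {A : V → V → Prop} {S : V → (V → Bool) → Option Bool}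
    (hS : IsStrategy A S) {v u : V} (h : ¬ A v u) (c : V → Bool) : S v (flip c u) = S v c :=
  hS v _ _ fun _ hw => flip_of_ne c fun e => h (e ▸ hw)

/-- Vertices that guess correctly at the winning configurations `c` and `d`, and whose flips lead
to the same configuration, see each other. -/
lemma IsStrategy.sees_of_flip_eq {A : V → V → Prop} (hA : ∀ v, ¬ A v v)
    {S : V → (V → Bool) → Option Bool} (hS : IsStrategy A S) {c d : V → Bool} {v w : V}
    (hd : Wins S d) (hv : S v c = some (c v)) (h : flip c v = flip d w)
    (hvw : v ≠ w) : A v w := by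
  by_contra hn
  have h1 : S v d = some (c v) := by
    rw [← hS.apply_flip hn d, ← h, hS.apply_flip (hA v), hv]
  have h2 : d v = !c v := by
    rw [← flip_of_ne d hvw, ← h, flip_self]
  have h3 := hd.2 v _ h1
  simp [h2] at h3

/-- The strategy where only `v` guesses, always the same color. -/
def constantStrategy (v : V) : V → (V → Bool) → Option Bool :=
  fun u _ => if u = v then some true else none

lemma isStrategy_constantStrategy (A : V → V → Prop) (v : V) :
    IsStrategy A (constantStrategy v) := fun _ _ _ _ => rfl

lemma wins_constantStrategy_iff (v : V) (c : V → Bool) :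
    Wins (constantStrategy v) c ↔ c v = true := by
  simp only [Wins, constantStrategy]
  constructor
  · rintro ⟨-, h⟩
    exact (h v true (by simp)).symm
  · intro h
    refine ⟨⟨v, by simp [h]⟩, fun u b hu => ?_⟩
    split_ifs at hu with huv
    subst huv
    simpa [h] using hu.symm

variable [Fintype V]

/-- In a digraph without loops and two-way arcs, a strategy wins at most half of the time. -/
lemma IsStrategy.chance_le_half {A : V → V → Prop} (hA : ∀ v, ¬ A v v)
    (hT : ∀ x y : V, A x y → ¬ A y x) {S : V → (V → Bool) → Option Bool}
    (hS : IsStrategy A S) : chance S ≤ 1 / 2 := by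
  have hex : ∀ c : {c // Wins S c}, ∃ v, S v c.1 = some (c.1 v) := fun c => c.2.1
  choose f hf using hex
  have hmem : ∀ c : {c // Wins S c}, ¬ Wins S (flip c.1 (f c)) := fun c hw => by
    have := hw.2 (f c) _ ((hS.apply_flip (hA _) _).trans (hf c))
    simp [flip_self] at this
  have hinj : Function.Injective fun c : {c // Wins S c} =>
      (⟨flip c.1 (f c), hmem c⟩ : {c // ¬ Wins S c}) := by
    intro c d h
    have h : flip c.1 (f c) = flip d.1 (f d) := congrArg Subtype.val h
    by_cases hvw : f c = f d
    · rw [hvw] at h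
      exact Subtype.ext (flip_injective _ h)
    · exact absurd (hS.sees_of_flip_eq hA c.2 (hf d) h.symm (Ne.symm hvw))
        (hT _ _ (hS.sees_of_flip_eq hA d.2 (hf c) h hvw))
  have hle : {c | Wins S c}.ncard ≤ {c | Wins S c}ᶜ.ncard := Nat.card_le_card_of_injective _ hinj
  have hsum := Set.ncard_add_ncard_compl {c | Wins S c}
  have hnat : 2 * {c | Wins S c}.ncard ≤ 2 ^ Fintype.card V := by
    simp only [Nat.card_eq_fintype_card, Fintype.card_fun, Fintype.card_bool] at hsum
    omega
  have hrat : (2 : ℚ) * {c | Wins S c}.ncard ≤ 2 ^ Fintype.card V := by exact_mod_cast hnat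
  rw [chance, div_le_iff₀ (by positivity)]
  linarith

lemma half_le_chance_constantStrategy (v : V) : 1 / 2 ≤ chance (constantStrategy v) := by
  have hle : {c | Wins (constantStrategy v) c}ᶜ.ncard ≤ {c | Wins (constantStrategy v) c}.ncard :=
    Set.ncard_le_ncard_of_injOn (fun c => flip c v)
      (fun c hc => by simpa [wins_constantStrategy_iff, flip_self] using hc)
      (flip_injective v).injOn
  have hsum := Set.ncard_add_ncard_compl {c | Wins (constantStrategy v) c}
  have hnat : 2 ^ Fintype.card V ≤ 2 * {c | Wins (constantStrategy v) c}.ncard := by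
    simp only [Nat.card_eq_fintype_card, Fintype.card_fun, Fintype.card_bool] at hsum
    omega
  have hrat : (2 : ℚ) ^ Fintype.card V ≤ 2 * {c | Wins (constantStrategy v) c}.ncard := by
    exact_mod_cast hnat
  rw [chance, le_div_iff₀ (by positivity)]
  linarith

end

/-- For every tournament `T` on at least one vertex we have `h(T) = 1/2`. -/
theorem hatNumber_tournament {V : Type*} [Fintype V] [DecidableEq V] [Nonempty V]
    (A : V → V → Prop) (hA : Irreflexive A)
    (hT : ∀ x y : V, x ≠ y → Xor' (A x y) (A y x)) :
    hatNumber A = 1 / 2 := by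
  have hasymm : ∀ x y : V, A x y → ¬ A y x := fun x y hxy hyx => by
    have hne : x ≠ y := fun e => hA x (by rwa [← e] at hxy)
    rcases hT x y hne with h | h
    · exact h.2 hyx
    · exact h.2 hxy
  obtain ⟨v⟩ := ‹Nonempty V›
  unfold hatNumber
  apply le_antisymm
  · exact Finset.sup'_le _ _ fun S _ => S.2.chance_le_half hA hasymm
  · refine (Finset.le_sup'_iff _).mpr ?_
    exact ⟨⟨_, isStrategy_constantStrategy A v⟩, @Finset.mem_univ _ (_) _,
      half_le_chance_constantStrategy v⟩

end HatProblem
end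

section
/- Let D be a digraph on at least two vertices and let v be a vertex of D with no outgoing arcs (i.e., the out-neighborhood N⁺(v) is empty). Then h(D) = h(D − v), where D − v is the induced subdigraph of D on the vertex set V ∖ {v}. -/
namespace HatProblem

theorem chance_le_hatNumber {V : Type*} [Fintype V] [DecidableEq V] {A : V → V → Prop}
    {S : V → (V → Bool) → Option Bool} (hS : IsStrategy A S) : chance S ≤ hatNumber A :=
  (@Finset.le_sup'_iff _ _ _ _ _ _ _).2 ⟨⟨S, hS⟩, @Finset.mem_univ _ (Fintype.ofFinite _) _, le_rfl⟩

theorem hatNumber_le {V : Type*} [Fintype V] [DecidableEq V] {A : V → V → Prop} {q : ℚ}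
    (h : ∀ S, IsStrategy A S → chance S ≤ q) : hatNumber A ≤ q :=
  Finset.sup'_le _ _ fun S _ => h S.1 S.2

/-- The configuration on `V` that gives `v` the color `b` and agrees with `c` elsewhere. -/
def extendConfig {V : Type*} [DecidableEq V] (v : V) (b : Bool) (c : {u : V // u ≠ v} → Bool) :
    V → Bool :=
  fun u => if h : u = v then b else c ⟨u, h⟩

/-- The strategy on the vertices other than `v` that plays `S` as if `v` had color `b`. -/
def restrictStrategy {V : Type*} [DecidableEq V] (v : V) (b : Bool)
    (S : V → (V → Bool) → Option Bool) :
    {u : V // u ≠ v} → ({u : V // u ≠ v} → Bool) → Option Bool :=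
  fun u c => S u (extendConfig v b c)

/-- The strategy in which `v` passes and the other vertices play `T`. -/
def extendStrategy {V : Type*} [DecidableEq V] (v : V)
    (T : {u : V // u ≠ v} → ({u : V // u ≠ v} → Bool) → Option Bool) :
    V → (V → Bool) → Option Bool :=
  fun u c => if h : u = v then none else T ⟨u, h⟩ fun w => c w

section

variable {V : Type*} [DecidableEq V]

@[simp]
theorem extendConfig_self (v : V) (b : Bool) (c : {u : V // u ≠ v} → Bool) :
    extendConfig v b c v = b := by
  simp [extendConfig]

@[simp]
theorem extendConfig_coe (v : V) (b : Bool) (c : {u : V // u ≠ v} → Bool)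
    (u : {u : V // u ≠ v}) : extendConfig v b c u = c u := by
  simp [extendConfig, u.2]

theorem extendConfig_restrict (v : V) (c : V → Bool) :
    extendConfig v (c v) (fun u => c u) = c := by
  funext u
  by_cases h : u = v <;> simp [extendConfig, h]

theorem extendConfig_injective (v : V) (b : Bool) : Function.Injective (extendConfig v b) := by
  intro c c' h
  funext u
  simpa using congrFun h u

theorem ncard_setOf_eq_add_extendConfig [Finite V] (v : V) (p : (V → Bool) → Prop) :
    {c | p c}.ncard =
      {c | p (extendConfig v false c)}.ncard + {c | p (extendConfig v true c)}.ncard := by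
  have hunion : {c | p c} = extendConfig v false '' {c | p (extendConfig v false c)} ∪
      extendConfig v true '' {c | p (extendConfig v true c)} := by
    ext c
    constructor
    · intro hc
      have hr := extendConfig_restrict v c
      cases hb : c v <;> rw [hb] at hr
      · exact Or.inl ⟨_, by simpa only [Set.mem_ofPred_eq, hr] using hc, hr⟩
      · exact Or.inr ⟨_, by simpa only [Set.mem_ofPred_eq, hr] using hc, hr⟩
    · rintro (⟨c, hc, rfl⟩ | ⟨c, hc, rfl⟩) <;> exact hc
  have hdisj : Disjoint (extendConfig v false '' {c | p (extendConfig v false c)})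
      (extendConfig v true '' {c | p (extendConfig v true c)}) := by
    rw [Set.disjoint_left]
    rintro _ ⟨c, -, rfl⟩ ⟨c', -, h⟩
    simpa using congrFun h v
  rw [hunion, Set.ncard_union_eq hdisj (Set.toFinite _) (Set.toFinite _),
    Set.ncard_image_of_injective _ (extendConfig_injective v _),
    Set.ncard_image_of_injective _ (extendConfig_injective v _)]

theorem isStrategy_restrictStrategy {A : V → V → Prop} {S : V → (V → Bool) → Option Bool}
    (hS : IsStrategy A S) (v : V) (b : Bool) :
    IsStrategy (fun x y : {u : V // u ≠ v} => A x y) (restrictStrategy v b S) := by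
  intro u c c' h
  refine hS u _ _ fun w hw => ?_
  by_cases hwv : w = v
  · subst hwv; simp
  · simpa [extendConfig, hwv] using h ⟨w, hwv⟩ hw

theorem isStrategy_extendStrategy {A : V → V → Prop} (v : V)
    {T : {u : V // u ≠ v} → ({u : V // u ≠ v} → Bool) → Option Bool}
    (hT : IsStrategy (fun x y : {u : V // u ≠ v} => A x y) T) :
    IsStrategy A (extendStrategy v T) := by
  intro u c c' h
  by_cases huv : u = v
  · simp [extendStrategy, huv]
  · simpa [extendStrategy, huv] using hT ⟨u, huv⟩ _ _ fun w hw => h w hw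

theorem restrictStrategy_extendStrategy (v : V) (b : Bool)
    (T : {u : V // u ≠ v} → ({u : V // u ≠ v} → Bool) → Option Bool) :
    restrictStrategy v b (extendStrategy v T) = T := by
  funext u c
  simp [restrictStrategy, extendStrategy, u.2]

theorem wins_extendConfig_iff {S : V → (V → Bool) → Option Bool} {v : V}
    (hpass : ∀ c, S v c = none) (b : Bool) (c : {u : V // u ≠ v} → Bool) :
    Wins S (extendConfig v b c) ↔ Wins (restrictStrategy v b S) c := by
  refine and_congr ⟨?_, ?_⟩ ⟨?_, ?_⟩
  · rintro ⟨u, hu⟩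
    have huv : u ≠ v := by
      rintro rfl
      simp [hpass] at hu
    exact ⟨⟨u, huv⟩, by simpa [restrictStrategy, extendConfig, huv] using hu⟩
  · rintro ⟨u, hu⟩
    exact ⟨u, by simpa [restrictStrategy] using hu⟩
  · intro h u b' hu
    simpa using h u b' hu
  · intro h u b' hu
    have huv : u ≠ v := by
      rintro rfl
      simp [hpass] at hu
    simpa [extendConfig, huv] using h ⟨u, huv⟩ b' hu

theorem card_eq_card_ne_add_one [Fintype V] (v : V) :
    Fintype.card V = Fintype.card {u : V // u ≠ v} + 1 := by
  have := Fintype.card_pos_iff.mpr ⟨v⟩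
  simp only [Fintype.card_subtype_compl, Fintype.card_unique, ne_eq]
  omega

theorem chance_eq_of_pass [Fintype V] {S : V → (V → Bool) → Option Bool} {v : V}
    (hpass : ∀ c, S v c = none) :
    chance S = (chance (restrictStrategy v false S) + chance (restrictStrategy v true S)) / 2 := by
  simp only [chance, ncard_setOf_eq_add_extendConfig v (Wins S), wins_extendConfig_iff hpass,
    card_eq_card_ne_add_one v, pow_succ, Nat.cast_add]
  field_simp

theorem ncard_setOf_apply_eq [Fintype V] (v : V) (b : Bool) :
    {c : V → Bool | c v = b}.ncard = 2 ^ Fintype.card {u : V // u ≠ v} := by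
  rw [ncard_setOf_eq_add_extendConfig v]
  cases b <;> simp [Set.ncard_univ, Nat.card_eq_fintype_card]

theorem ncard_setOf_apply_eq_div [Fintype V] (v : V) (b : Bool) :
    ({c : V → Bool | c v = b}.ncard : ℚ) / 2 ^ Fintype.card V = 1 / 2 := by
  rw [ncard_setOf_apply_eq, card_eq_card_ne_add_one v, pow_succ]
  push_cast
  field_simp

theorem chance_le_half_of_const [Fintype V] {S : V → (V → Bool) → Option Bool} {v : V} {b : Bool}
    (hconst : ∀ c, S v c = some b) : chance S ≤ 1 / 2 := by
  rw [← ncard_setOf_apply_eq_div v b, chance]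
  gcongr
  · exact Set.toFinite _
  · rename_i c
    exact fun hc => (hc.2 v b (hconst c)).symm

theorem half_le_hatNumber [Fintype V] (A : V → V → Prop) (v : V) : 1 / 2 ≤ hatNumber A := by
  let S : V → (V → Bool) → Option Bool := fun u _ => if u = v then some true else none
  have hS : IsStrategy A S := fun _ _ _ _ => rfl
  refine le_trans (le_of_eq ?_) (chance_le_hatNumber hS)
  rw [← ncard_setOf_apply_eq_div v true, chance]
  congr 3
  ext c
  constructor
  · intro hc
    refine ⟨⟨v, by simpa [S] using hc.symm⟩, fun u b hu => ?_⟩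
    by_cases huv : u = v
    · subst huv
      exact (by simpa [S] using hu : true = b) ▸ hc.symm
    · simp [S, huv] at hu
  · exact fun hc => (hc.2 v true (by simp [S])).symm

end

/-- If a vertex `v` of `D` has no outgoing arcs, then `h(D) = h(D - v)`. -/
theorem hatNumber_eq_of_no_outgoing {V : Type*} [Fintype V] [DecidableEq V]
    (A : V → V → Prop) (hA : Irreflexive A) (hcard : 1 < Fintype.card V) (v : V)
    (hv : ∀ u : V, ¬ A v u) :
    hatNumber A = hatNumber (fun a b : {u : V // u ≠ v} => A a.1 b.1) := by
  apply le_antisymm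
  · refine hatNumber_le fun S hS => ?_
    have hconst (c c' : V → Bool) : S v c = S v c' := hS v c c' fun u hu => absurd hu (hv u)
    cases hb : S v fun _ => false with
    | none =>
      rw [chance_eq_of_pass fun c => (hconst c _).trans hb]
      have h₀ := chance_le_hatNumber (isStrategy_restrictStrategy hS v false)
      have h₁ := chance_le_hatNumber (isStrategy_restrictStrategy hS v true)
      linarith
    | some b =>
      obtain ⟨u, hu⟩ := Fintype.exists_ne_of_one_lt_card hcard v
      exact (chance_le_half_of_const fun c => (hconst c _).trans hb).trans
        (half_le_hatNumber _ ⟨u, hu⟩)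
  · refine hatNumber_le fun T hT => ?_
    have hpass (c : V → Bool) : extendStrategy v T v c = none := by simp [extendStrategy]
    have h := chance_eq_of_pass hpass
    simp only [restrictStrategy_extendStrategy, add_self_div_two] at h
    exact h ▸ chance_le_hatNumber (isStrategy_extendStrategy v hT)

end HatProblem
end

section
/- Let D be a digraph such that ω(D) + 1 is not a power of two. Then h(D) < ω(D)/(ω(D)+1). -/
namespace HatProblem

lemma IsDiClique.card_le_cliqueNum {V : Type*} [Fintype V] {A : V → V → Prop} {s : Finset V}
    (hs : IsDiClique A s) : s.card ≤ cliqueNum A := by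
  refine le_csSup ⟨Fintype.card V, ?_⟩ ⟨s, hs, rfl⟩
  rintro n ⟨t, -, rfl⟩
  exact t.card_le_univ

/-- The configuration obtained from `c` by changing the color of `v`. -/
def flipAt {V : Type*} [DecidableEq V] (c : V → Bool) (v : V) : V → Bool :=
  Function.update c v (!c v)

lemma flipAt_flipAt {V : Type*} [DecidableEq V] (c : V → Bool) (v : V) :
    flipAt (flipAt c v) v = c := by
  simp [flipAt]

/-- A strategy's guess at `v` does not change when an out-non-neighbor of `v` is recolored. -/
lemma IsStrategy.apply_flipAt {V : Type*} [DecidableEq V] {A : V → V → Prop}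
    {S : V → (V → Bool) → Option Bool} (hS : IsStrategy A S) {v u : V} (h : ¬ A v u)
    (c : V → Bool) : S v (flipAt c u) = S v c := by
  refine hS v _ _ fun w hw => ?_
  have hne : w ≠ u := by rintro rfl; exact h hw
  simp [flipAt, hne]

/-- At any configuration, the vertices that guess wrong and whose recoloring makes the team win
form a clique. -/
lemma IsStrategy.isDiClique_of_wrong_of_wins {V : Type*} [DecidableEq V] {A : V → V → Prop}
    {S : V → (V → Bool) → Option Bool} (hS : IsStrategy A S) {c : V → Bool} {s : Finset V}
    (hs : ∀ u ∈ s, S u c = some (!c u) ∧ Wins S (flipAt c u)) : IsDiClique A s := by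
  have key : ∀ x ∈ s, ∀ y ∈ s, x ≠ y → A x y := by
    intro x hx y hy hxy
    by_contra hA
    have h := (hs y hy).2.2 x _ ((hS.apply_flipAt hA c).trans (hs x hx).1)
    simp [flipAt, hxy] at h
  exact fun x hx y hy hxy => ⟨key x hx y hy hxy, key y hy x hx hxy.symm⟩

open Classical in
/-- There are at most `ω(D)` times as many winning as losing configurations. -/
lemma IsStrategy.card_wins_le {V : Type*} [Fintype V] [DecidableEq V] {A : V → V → Prop}
    (hA : Irreflexive A) {S : V → (V → Bool) → Option Bool} (hS : IsStrategy A S) :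
    (Finset.univ.filter fun c => Wins S c).card ≤
      cliqueNum A * (Finset.univ.filter fun c => ¬ Wins S c).card := by
  set W := Finset.univ.filter fun c => Wins S c
  set L := Finset.univ.filter fun c => ¬ Wins S c
  have hex : ∀ c : W, ∃ v, S v c.1 = some (c.1 v) := fun c => (Finset.mem_filter.1 c.2).2.1
  choose v hv using hex
  have hwrong : ∀ c : W, S (v c) (flipAt c.1 (v c)) = some (!flipAt c.1 (v c) (v c)) := fun c => by
    rw [hS.apply_flipAt (hA (v c)), hv]
    simp [flipAt]
  have hmaps : ∀ c ∈ (Finset.univ : Finset W), flipAt c.1 (v c) ∈ L := fun c _ => by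
    refine Finset.mem_filter.2 ⟨Finset.mem_univ _, fun hw => ?_⟩
    simpa using hw.2 _ _ (hwrong c)
  have hcard := Finset.card_le_mul_card_image_of_maps_to hmaps (cliqueNum A) fun l _ => by
    set B := Finset.univ.filter fun u => S u l = some (!l u) ∧ Wins S (flipAt l u)
    have hB : IsDiClique A B :=
      hS.isDiClique_of_wrong_of_wins fun u hu => (Finset.mem_filter.1 hu).2
    refine le_trans (Finset.card_le_card_of_injOn v ?_ ?_) hB.card_le_cliqueNum
    · intro c hc
      obtain rfl := (Finset.mem_filter.1 hc).2
      refine Finset.mem_coe.2 (Finset.mem_filter.2 ⟨Finset.mem_univ _, hwrong c, ?_⟩)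
      rw [flipAt_flipAt]
      exact (Finset.mem_filter.1 c.2).2
    · intro c hc d hd hcd
      have hc' := (Finset.mem_filter.1 hc).2
      have hd' := (Finset.mem_filter.1 hd).2
      apply Subtype.ext
      rw [← flipAt_flipAt c.1 (v c), ← flipAt_flipAt d.1 (v d), hc', hd', hcd]
  simpa using hcard

/-- If `ω(D) + 1` is not a power of two, then `h(D) < ω(D)/(ω(D)+1)`. -/
theorem hatNumber_lt_of_not_pow_two {V : Type*} [Fintype V] [DecidableEq V]
    (A : V → V → Prop) (hA : Irreflexive A)
    (h : ¬ ∃ k : ℕ, cliqueNum A + 1 = 2 ^ k) :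
    hatNumber A < (cliqueNum A : ℚ) / ((cliqueNum A : ℚ) + 1) := by
  classical
  refine (Finset.sup'_lt_iff _).2 ?_
  rintro ⟨S, hS⟩ -
  have hle := hS.card_wins_le hA
  have hsum := Finset.card_filter_add_card_filter_not (s := (Finset.univ : Finset (V → Bool)))
    fun c => Wins S c
  have hncard : {c : V → Bool | Wins S c}.ncard = (Finset.univ.filter fun c => Wins S c).card := by
    rw [← Set.ncard_coe_finset]
    simp
  simp only [Finset.card_univ, Fintype.card_fun, Fintype.card_bool] at hsum
  rw [chance, hncard, div_lt_div_iff₀ (by positivity) (by positivity)]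
  generalize (Finset.univ.filter fun c => Wins S c).card = w at *
  generalize (Finset.univ.filter fun c => ¬ Wins S c).card = l at *
  norm_cast
  rw [← hsum]
  refine lt_of_le_of_ne (by nlinarith) fun heq => h ?_
  have hdvd : cliqueNum A + 1 ∣ 2 ^ Fintype.card V := by
    refine Nat.Coprime.dvd_of_dvd_mul_left (m := cliqueNum A) (by simp) ?_
    rw [← hsum, ← heq]
    exact dvd_mul_left _ _
  obtain ⟨k, -, hk⟩ := (Nat.dvd_prime_pow Nat.prime_two).1 hdvd
  exact ⟨k, hk⟩

end HatProblem
end
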